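/- Let ψ be a unit vector in H_f ⊗ H_{f'}, F_f^α a projective measurement on H_f, F_{f'}^α a projective measurement on H_{f'}, such that for all α, ⟨ψ| (F_f^α ⊗ F_{f'}^α) |ψ⟩ = ⟨ψ| (F_f^α ⊗ I) |ψ⟩. Then for every α, (F_f^α ⊗ I) ψ = (I ⊗ F_{f'}^α) ψ (the record on f' can replace the measurement on f on the state ψ). -/

import Mathlib

open scoped Kronecker
open Matrix

/-- If the projective measurement F_{f'} on the second factor perfectly
records the projective measurement F_f on the first factor on the unit vector ψ, then
the record can replace the measurement on ψ: (F_f^α ⊗ I) ψ = (I ⊗ F_{f'}^α) ψ. -/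
theorem perfect_record_replaces_measurement
    {m n A : Type*} [Fintype m] [Fintype n] [Fintype A]
    [DecidableEq m] [DecidableEq n]
    (ψ : m × n → ℂ) (hψ : star ψ ⬝ᵥ ψ = 1)
    (P : A → Matrix m m ℂ) (Q : A → Matrix n n ℂ)
    (hPherm : ∀ α, (P α).IsHermitian) (hPidem : ∀ α, P α * P α = P α)
    (hPorth : ∀ α β, α ≠ β → P α * P β = 0) (hPsum : ∑ α, P α = 1)
    (hQherm : ∀ α, (Q α).IsHermitian) (hQidem : ∀ α, Q α * Q α = Q α)
    (hQorth : ∀ α β, α ≠ β → Q α * Q β = 0) (hQsum : ∑ α, Q α = 1)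
    (hrec : ∀ α, star ψ ⬝ᵥ ((P α ⊗ₖ Q α) *ᵥ ψ)
                = star ψ ⬝ᵥ ((P α ⊗ₖ (1 : Matrix n n ℂ)) *ᵥ ψ)) :
    ∀ α, (P α ⊗ₖ (1 : Matrix n n ℂ)) *ᵥ ψ = ((1 : Matrix m m ℂ) ⊗ₖ Q α) *ᵥ ψ := by
  classical
  have key : ∀ α, (P α ⊗ₖ (1 : Matrix n n ℂ)) *ᵥ ψ = (P α ⊗ₖ Q α) *ᵥ ψ := by
    intro α
    have hd : (P α ⊗ₖ (1 : Matrix n n ℂ) - P α ⊗ₖ Q α) *ᵥ ψ = 0 := by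
      set R := P α ⊗ₖ (1 : Matrix n n ℂ) - P α ⊗ₖ Q α with hR
      have hRh : Rᴴ = R := by
        rw [hR, conjTranspose_sub, conjTranspose_kronecker, conjTranspose_kronecker,
          (hPherm α).eq, (hQherm α).eq, conjTranspose_one]
      have hRi : R * R = R := by
        rw [hR]
        simp only [sub_mul, mul_sub, ← mul_kronecker_mul, hPidem, hQidem, one_mul, mul_one]
        abel
      have h0 : star ψ ⬝ᵥ (R *ᵥ ψ) = 0 := by
        rw [hR, sub_mulVec, dotProduct_sub, hrec α, sub_self]
      have h1 : star (R *ᵥ ψ) ⬝ᵥ (R *ᵥ ψ) = 0 := by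
        rw [star_mulVec, hRh, ← dotProduct_mulVec, mulVec_mulVec, hRi, h0]
      open scoped ComplexOrder in
      exact dotProduct_star_self_eq_zero.mp h1
    rw [sub_mulVec] at hd
    exact sub_eq_zero.mp hd
  have cross : ∀ α β, β ≠ α → (P β ⊗ₖ Q α) *ᵥ ψ = 0 := by
    intro α β h
    have e : P β ⊗ₖ Q α = ((1 : Matrix m m ℂ) ⊗ₖ Q α) * (P β ⊗ₖ (1 : Matrix n n ℂ)) := by
      rw [← mul_kronecker_mul, one_mul, mul_one]
    rw [e, ← mulVec_mulVec, key β, mulVec_mulVec, ← mul_kronecker_mul, hQorth α β h.symm,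
      kronecker_zero, zero_mulVec]
  intro α
  have hs : (1 : Matrix m m ℂ) ⊗ₖ Q α = ∑ β, P β ⊗ₖ Q α := by
    rw [← hPsum]
    ext i j
    simp [Matrix.sum_apply, kroneckerMap_apply, Finset.sum_mul]
  rw [key α, hs, sum_mulVec, Finset.sum_eq_single α (fun β _ h => cross α β h) (by simp)]
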